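/- Every nonconstant operator monotone function f : [0,∞) → [0,∞) is injective. -/

import Mathlib

open ContinuousLinearMap Filter Topology MeasureTheory
open scoped NNReal ENNReal

set_option synthInstance.maxHeartbeats 1000000
set_option maxHeartbeats 1000000

noncomputable section

variable {H : Type} [NormedAddCommGroup H] [InnerProductSpace ℂ H] [CompleteSpace H]

/-- Convergence of a sequence of bounded operators in the strong operator topology. -/
def SOTTendsto (A : ℕ → H →L[ℂ] H) (A₀ : H →L[ℂ] H) : Prop :=
  ∀ x : H, Tendsto (fun n => A n x) atTop (𝓝 (A₀ x))

/-- A Kubo–Ando operator connection on the positive bounded operators on `H`: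
a binary operation on positive operators (hence positivity of the output) satisfying
monotonicity (M1), the transformer inequality (M2) and continuity from above (M3). -/
structure IsConnection (σ : (H →L[ℂ] H) → (H →L[ℂ] H) → (H →L[ℂ] H)) : Prop where
  isPositive : ∀ A B : H →L[ℂ] H, A.IsPositive → B.IsPositive → (σ A B).IsPositive
  mono : ∀ A B C D : H →L[ℂ] H, A.IsPositive → B.IsPositive → C.IsPositive → D.IsPositive →
    A ≤ C → B ≤ D → σ A B ≤ σ C D
  transformer : ∀ A B C : H →L[ℂ] H, A.IsPositive → B.IsPositive → C.IsPositive →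
    C * σ A B * C ≤ σ (C * A * C) (C * B * C)
  contFromAbove : ∀ (A B : ℕ → H →L[ℂ] H) (A₀ B₀ : H →L[ℂ] H),
    (∀ n, (A n).IsPositive) → (∀ n, (B n).IsPositive) → A₀.IsPositive → B₀.IsPositive →
    Antitone A → Antitone B → SOTTendsto A A₀ → SOTTendsto B B₀ →
    Antitone (fun n => σ (A n) (B n)) ∧ SOTTendsto (fun n => σ (A n) (B n)) (σ A₀ B₀)

/-- A function `f : [0,∞) → [0,∞)` is operator monotone if for every complex Hilbert
space `K` and all positive bounded operators `A ≤ B` on `K` one has `f(A) ≤ f(B)`,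
where `f` is applied via the continuous functional calculus. -/
def OperatorMonotone (f : ℝ≥0 → ℝ≥0) : Prop :=
  ∀ (K : Type) [NormedAddCommGroup K] [InnerProductSpace ℂ K] [CompleteSpace K],
    ∀ A B : K →L[ℂ] K, A.IsPositive → B.IsPositive → A ≤ B → cfc f A ≤ cfc f B

/-- `f` is the representing function of the connection `σ`: `f` is operator monotone
and `f(x)·I = I σ (x·I)` for all `x ≥ 0`. -/
def IsRepresentingFunction (σ : (H →L[ℂ] H) → (H →L[ℂ] H) → (H →L[ℂ] H))
    (f : ℝ≥0 → ℝ≥0) : Prop :=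
  OperatorMonotone f ∧
    ∀ x : ℝ≥0, σ 1 ((x : ℝ) • (1 : H →L[ℂ] H)) = (f x : ℝ) • (1 : H →L[ℂ] H)

/-- The kernel `t ↦ 1 !ₜ x = x / ((1-t)x + t)`, with the conventions
`1 !₀ x = 1` for every `x` (in particular `1 !₀ 0 = 1`) and `1 !ₜ 0 = 0` for `t > 0`. -/
def harmKernel (t : ℝ) (x : ℝ≥0) : ℝ≥0∞ :=
  if t = 0 then 1 else ENNReal.ofReal ((x : ℝ) / ((1 - t) * (x : ℝ) + t))

/-- `μ` is the associated (finite Borel) measure of a connection with representing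
function `f`: `μ` is supported on `[0,1]` and `f(x) = ∫_{[0,1]} (1 !ₜ x) dμ(t)`. -/
def IsAssociatedMeasure (f : ℝ≥0 → ℝ≥0) (μ : Measure ℝ) : Prop :=
  μ (Set.Icc (0:ℝ) 1)ᶜ = 0 ∧
    ∀ x : ℝ≥0, (f x : ℝ≥0∞) = ∫⁻ t in Set.Icc (0:ℝ) 1, harmKernel t x ∂μ

/-- `g` is the transpose of `f`: `g(x) = x·f(1/x)` for `x > 0`, extended to `0` by
continuity, i.e. `g(0) = lim_{x→0⁺} x·f(1/x)`. -/
def IsTransposeFunction (g f : ℝ≥0 → ℝ≥0) : Prop :=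
  (∀ x : ℝ≥0, x ≠ 0 → g x = x * f x⁻¹) ∧
    Tendsto (fun x : ℝ≥0 => x * f x⁻¹) (𝓝[>] (0 : ℝ≥0)) (𝓝 (g 0))

/-- The operator `a (1 - p) + b p`; when `p` is a projection it has eigenvalue `b` on the range
of `p` and `a` on its orthogonal complement. -/
def twoValued {K : Type} [NormedAddCommGroup K] [InnerProductSpace ℂ K]
    (a b : ℝ) (p : K →L[ℂ] K) : K →L[ℂ] K :=
  a • (1 : K →L[ℂ] K) + (b - a) • p

lemma cfc_real_isStarProjection {K : Type} [NormedAddCommGroup K] [InnerProductSpace ℂ K]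
    [CompleteSpace K] {p : K →L[ℂ] K} (hp : IsStarProjection p) (h : ℝ → ℝ) :
    cfc h p = twoValued (h 0) (h 1) p := by
  have hsa : IsSelfAdjoint p := hp.isSelfAdjoint
  have key : Set.EqOn h (fun x => h 0 + (h 1 - h 0) * x) (spectrum ℝ p) := by
    intro x hx
    rcases hp.isIdempotentElem.spectrum_subset ℝ hx with rfl | rfl <;> simp
  rw [cfc_congr key, cfc_const_add _ _ _, cfc_const_mul_id _ _, twoValued,
    Algebra.algebraMap_eq_smul_one]

lemma cfc_isStarProjection {K : Type} [NormedAddCommGroup K] [InnerProductSpace ℂ K]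
    [CompleteSpace K] {p : K →L[ℂ] K} (hp : IsStarProjection p) (h : ℝ≥0 → ℝ≥0) :
    cfc h p = twoValued (h 0) (h 1) p := by
  have h0 : 0 ≤ p := hp.nonneg
  rw [cfc_nnreal_eq_real h p, cfc_real_isStarProjection hp]
  simp

lemma finite_spectrum_nnreal_isStarProjection {K : Type} [NormedAddCommGroup K]
    [InnerProductSpace ℂ K] [CompleteSpace K] {p : K →L[ℂ] K} (hp : IsStarProjection p) :
    (spectrum ℝ≥0 p).Finite := by
  rw [← spectrum.preimage_algebraMap (R := ℝ≥0) ℝ]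
  exact (hp.isIdempotentElem.finite_spectrum ℝ).preimage (NNReal.coe_injective.injOn)

lemma twoValued_eq_cfc {K : Type} [NormedAddCommGroup K] [InnerProductSpace ℂ K]
    [CompleteSpace K] {p : K →L[ℂ] K} (hp : IsStarProjection p) (a b : ℝ≥0) :
    twoValued a b p = cfc (fun x : ℝ≥0 => if x = 0 then a else b) p := by
  simp [cfc_isStarProjection hp]

lemma isPositive_twoValued {K : Type} [NormedAddCommGroup K] [InnerProductSpace ℂ K]
    [CompleteSpace K] {p : K →L[ℂ] K} (hp : IsStarProjection p) (a b : ℝ≥0) :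
    (twoValued (a : ℝ) b p).IsPositive := by
  rw [twoValued_eq_cfc hp, ← nonneg_iff_isPositive]
  exact cfc_predicate _ p

lemma cfc_twoValued {K : Type} [NormedAddCommGroup K] [InnerProductSpace ℂ K]
    [CompleteSpace K] {p : K →L[ℂ] K} (hp : IsStarProjection p) (f : ℝ≥0 → ℝ≥0) (a b : ℝ≥0) :
    cfc f (twoValued (a : ℝ) b p) = twoValued (f a) (f b) p := by
  have hfin := finite_spectrum_nnreal_isStarProjection hp
  have h0 : 0 ≤ p := hp.nonneg
  rw [twoValued_eq_cfc hp a b, ← cfc_comp f _ p h0 ((hfin.image _).continuousOn f)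
    (hfin.continuousOn _), cfc_isStarProjection hp]
  simp

lemma OperatorMonotone.twoValued_le {f : ℝ≥0 → ℝ≥0} (hf : OperatorMonotone f) {K : Type}
    [NormedAddCommGroup K] [InnerProductSpace ℂ K] [CompleteSpace K] {p q : K →L[ℂ] K}
    (hp : IsStarProjection p) (hq : IsStarProjection q) {a b c d : ℝ≥0}
    (h : twoValued (a : ℝ) b p ≤ twoValued (c : ℝ) d q) :
    twoValued (f a : ℝ) (f b) p ≤ twoValued (f c : ℝ) (f d) q := by
  rw [← cfc_twoValued hp, ← cfc_twoValued hq]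
  exact hf K _ _ (isPositive_twoValued hp a b) (isPositive_twoValued hq c d) h

lemma OperatorMonotone.monotone {f : ℝ≥0 → ℝ≥0} (hf : OperatorMonotone f) : Monotone f := by
  intro a b hab
  have h1 : twoValued (a : ℝ) a (0 : ℂ →L[ℂ] ℂ) ≤ twoValued (b : ℝ) b (0 : ℂ →L[ℂ] ℂ) := by
    rw [← sub_nonneg, nonneg_iff_isPositive]
    convert isPositive_twoValued (.zero (ℂ →L[ℂ] ℂ)) (b - a) (b - a) using 1
    simp [twoValued, NNReal.coe_sub hab, sub_smul]
  have h2 := (hf.twoValued_le (.zero _) (.zero _) h1).re_inner_nonneg_left (1 : ℂ)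
  simp [twoValued] at h2
  exact_mod_cast h2

/-- Two non-parallel rank-one projections `p`, `q` on a plane with
`γ p ≤ β + (α - β) q` whenever `0 ≤ γ < α` and `0 < β`. -/
lemma exists_isStarProjection_smul_le {α β γ : ℝ} (hβ : 0 < β) (hγ : 0 ≤ γ) (hγα : γ < α) :
    ∃ p q : EuclideanSpace ℂ (Fin 2) →L[ℂ] EuclideanSpace ℂ (Fin 2),
      IsStarProjection p ∧ IsStarProjection q ∧
      γ • p ≤ β • (1 : EuclideanSpace ℂ (Fin 2) →L[ℂ] EuclideanSpace ℂ (Fin 2)) + (α - β) • q ∧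
      ∀ s t : ℝ, t • p ≤ s • q → t ≤ 0 := by
  have hα : 0 < α := hγ.trans_lt hγα
  set r : ℝ := β * (α - γ) / (α * γ + α * β) with hr
  have hD : 0 < α * γ + α * β := by positivity
  have hr0 : 0 < r := div_pos (mul_pos hβ (sub_pos.2 hγα)) hD
  have hr1 : r ≤ 1 := by
    rw [hr, div_le_one hD]; nlinarith
  obtain ⟨S, hS⟩ : ∃ S : ℝ, S ^ 2 = r := ⟨√r, Real.sq_sqrt hr0.le⟩
  obtain ⟨C, hC⟩ : ∃ C : ℝ, C ^ 2 = 1 - r := ⟨√(1 - r), Real.sq_sqrt (by linarith)⟩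
  have hkey : γ * (C ^ 2 * β + S ^ 2 * α) ≤ α * β := by
    have hrD : r * (α * γ + α * β) = β * (α - γ) := div_mul_cancel₀ _ hD.ne'
    have h1 : 0 ≤ r * (α * β) := by positivity
    have h2 : 0 ≤ γ * r * β := by positivity
    rw [hS, hC]
    linarith
  have hreal : ∀ x y : ℝ, 0 ≤ α * x ^ 2 + β * y ^ 2 - γ * (C * x + S * y) ^ 2 := by
    intro x y
    have h1 : 0 ≤ α * x ^ 2 + β * y ^ 2 := by positivity
    refine (mul_nonneg_iff_of_pos_left (mul_pos hα hβ)).1 ?_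
    have h2 := mul_le_mul_of_nonneg_right hkey h1
    have h3 : 0 ≤ γ * (β * C * y - α * S * x) ^ 2 := by positivity
    linarith
  set u : EuclideanSpace ℂ (Fin 2) := !₂[(C : ℂ), (S : ℂ)] with hu
  set e : EuclideanSpace ℂ (Fin 2) := !₂[(1 : ℂ), (0 : ℂ)] with he
  have hun : ‖u‖ = 1 := by
    rw [EuclideanSpace.norm_eq]; simp [hu, hS, hC]
  have hen : ‖e‖ = 1 := by
    rw [EuclideanSpace.norm_eq]; simp [he]
  refine ⟨InnerProductSpace.rankOne ℂ u u, InnerProductSpace.rankOne ℂ e e,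
    InnerProductSpace.isStarProjection_rankOne_self hun,
    InnerProductSpace.isStarProjection_rankOne_self hen, ?_, ?_⟩
  · rw [ContinuousLinearMap.le_def, isPositive_def']
    refine ⟨?_, fun v => ?_⟩
    · have hu' := (InnerProductSpace.isStarProjection_rankOne_self (𝕜 := ℂ) hun).isSelfAdjoint
      have he' := (InnerProductSpace.isStarProjection_rankOne_self (𝕜 := ℂ) hen).isSelfAdjoint
      exact (((IsSelfAdjoint.all β).smul (.one _)).add ((IsSelfAdjoint.all _).smul he')).sub
        ((IsSelfAdjoint.all γ).smul hu')
    · have h1 := add_nonneg (hreal (v 0).re (v 1).re) (hreal (v 0).im (v 1).im)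
      refine h1.trans_eq ?_
      simp [reApplyInnerSelf_apply, hu, he, PiLp.inner_apply, Fin.sum_univ_two]
      ring
  · intro s t h
    have h2 := h.re_inner_nonneg_left !₂[(0 : ℂ), (1 : ℂ)]
    simp [hu, he, PiLp.inner_apply, Fin.sum_univ_two] at h2
    nlinarith

lemma eq_of_eq_of_gt {f : ℝ≥0 → ℝ≥0} (hf : OperatorMonotone f) {a b x : ℝ≥0} (hab : a < b)
    (hfab : f a = f b) (hx : b < x) : f x = f b := by
  refine le_antisymm ?_ (hf.monotone hx.le)
  obtain ⟨p, q, hp, hq, hle, hst⟩ := exists_isStarProjection_smul_le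
    (α := (x + 1 : ℝ) - a) (β := b - a) (γ := x - a) (sub_pos.2 (by exact_mod_cast hab))
    (sub_nonneg.2 (by exact_mod_cast (hab.trans hx).le)) (by linarith)
  have h1 : twoValued (a : ℝ) x p ≤ twoValued (b : ℝ) (x + 1 : ℝ≥0) q := by
    rw [← sub_nonneg] at hle ⊢
    convert hle using 1
    simp only [twoValued]
    push_cast
    module
  have h2 := hf.twoValued_le hp hq h1
  have h3 := hst ((f (x + 1) : ℝ) - f b) (f x - f b) <| by
    rw [← sub_nonneg] at h2 ⊢
    convert h2 using 1
    simp only [twoValued, hfab]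
    module
  exact_mod_cast sub_nonpos.1 h3

lemma eq_of_eq_of_lt {f : ℝ≥0 → ℝ≥0} (hf : OperatorMonotone f) {a b y : ℝ≥0} (hab : a < b)
    (hfab : f a = f b) (hy0 : 0 < y) (hy : y < a) : f y = f a := by
  refine le_antisymm (hf.monotone hy.le) ?_
  obtain ⟨p, q, hp, hq, hle, hst⟩ := exists_isStarProjection_smul_le
    (α := (b : ℝ)) (β := b - a) (γ := b - y) (sub_pos.2 (by exact_mod_cast hab))
    (sub_nonneg.2 (by exact_mod_cast (hy.trans hab).le)) (sub_lt_self _ (by exact_mod_cast hy0))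
  have h1 : twoValued (a : ℝ) (0 : ℝ≥0) q ≤ twoValued (b : ℝ) y p := by
    rw [← sub_nonneg] at hle ⊢
    convert hle using 1
    simp only [twoValued]
    push_cast
    module
  have h2 := hf.twoValued_le hq hp h1
  have h3 := hst ((f a : ℝ) - f 0) (f a - f y) <| by
    rw [← sub_nonneg] at h2 ⊢
    convert h2 using 1
    simp only [twoValued, hfab]
    module
  exact_mod_cast sub_nonpos.1 h3

/-- A diagonal operator with eigenvalues accumulating at `0`, dominating a rank-one projection. -/
lemma exists_isStarProjection_le_of_geometric_spectrum :
    ∃ p B : lp (fun _ : ℕ => ℂ) 2 →L[ℂ] lp (fun _ : ℕ => ℂ) 2,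
      IsStarProjection p ∧ p ≠ 0 ∧ p ≤ B ∧ ∀ n : ℕ, (1 / 2 : ℝ≥0) ^ n ∈ spectrum ℝ≥0 B := by
  set e : ℕ → lp (fun _ : ℕ => ℂ) 2 := fun n => lp.single 2 n (1 : ℂ) with he
  have hen : ∀ n, ‖e n‖ = 1 := fun n => by simp [he, lp.norm_single]
  have hin : ∀ m n, m ≠ n → inner ℂ (e m) (e n) = 0 := fun m n hmn => by
    simp [he, lp.inner_single_left, hmn]
  set R : ℕ → (lp (fun _ : ℕ => ℂ) 2 →L[ℂ] lp (fun _ : ℕ => ℂ) 2) :=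
    fun n => ((1 / 2 : ℝ) ^ n) • InnerProductSpace.rankOne ℂ (e n) (e n) with hR
  have hsum : Summable R := by
    refine Summable.of_norm ?_
    simpa [hR, norm_smul, hen] using summable_geometric_two
  have hR0 : ∀ n, 0 ≤ R n := fun n =>
    (nonneg_iff_isPositive _).2 <| by
      have h := (InnerProductSpace.isPositive_rankOne_self (𝕜 := ℂ) (e n)).smul_of_nonneg
        (c := (((1 / 2 : ℝ) ^ n : ℝ) : ℂ)) (by exact_mod_cast (by positivity : 0 ≤ (1 / 2 : ℝ) ^ n))
      rwa [Complex.coe_smul] at h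
  have hBe : ∀ n, (∑' k, R k) (e n) = ((1 / 2 : ℝ) ^ n) • e n := by
    intro n
    have h1 := hsum.hasSum.mapL (ContinuousLinearMap.apply ℂ _ (e n))
    refine h1.unique ?_
    convert hasSum_single n ?_ using 1
    · simp [hR, hen]
    · intro m hm
      simp [hR, hin m n hm]
  have h0 : InnerProductSpace.rankOne ℂ (e 0) (e 0) = R 0 := by simp [hR]
  have he0 : ∀ n, e n ≠ 0 := fun n h => by simpa [h] using hen n
  refine ⟨_, ∑' k, R k, InnerProductSpace.isStarProjection_rankOne_self (hen 0),
    InnerProductSpace.rankOne_ne_zero (he0 0) (he0 0), ?_, fun n => ?_⟩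
  · rw [h0]
    exact hsum.le_tsum 0 fun n _ => hR0 n
  · rw [spectrum.mem_iff]
    intro hu
    apply he0 n
    have hinj := (ContinuousLinearMap.isUnit_iff_bijective.1 hu).1
    apply hinj
    simp [hBe, Algebra.algebraMap_eq_smul_one, NNReal.smul_def]

lemma OperatorMonotone.apply_zero_ge {f : ℝ≥0 → ℝ≥0} (hf : OperatorMonotone f) {c : ℝ≥0}
    (hc : ∀ x, 0 < x → f x = c) {K : Type} [NormedAddCommGroup K] [InnerProductSpace ℂ K]
    [CompleteSpace K] {p B : K →L[ℂ] K} (hp : IsStarProjection p) (hp0 : p ≠ 0) (hpB : p ≤ B)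
    (hB : ∀ n : ℕ, (1 / 2 : ℝ≥0) ^ n ∈ spectrum ℝ≥0 B) : c ≤ f 0 := by
  by_contra! h0
  have hpn : 0 ≤ p := hp.nonneg
  have hBn : 0 ≤ B := hpn.trans hpB
  have hlim : Tendsto (fun n : ℕ => (1 / 2 : ℝ≥0) ^ n) atTop (𝓝 0) :=
    NNReal.tendsto_pow_atTop_nhds_zero_of_lt_one (by norm_num [← NNReal.coe_lt_coe])
  have h0mem : (0 : ℝ≥0) ∈ spectrum ℝ≥0 B :=
    (ContinuousFunctionalCalculus.isCompact_spectrum (R := ℝ≥0) (p := (0 ≤ ·)) B).isClosed.mem_of_tendsto hlim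
      (Eventually.of_forall hB)
  have hnc : ¬ ContinuousOn f (spectrum ℝ≥0 B) := by
    intro hcont
    have h1 := (hcont 0 h0mem).tendsto.comp
      (tendsto_nhdsWithin_iff.2 ⟨hlim, Eventually.of_forall hB⟩)
    have h2 : f ∘ (fun n : ℕ => (1 / 2 : ℝ≥0) ^ n) = fun _ => c :=
      funext fun n => hc _ (by positivity)
    rw [h2] at h1
    exact h0.ne' (tendsto_nhds_unique tendsto_const_nhds h1)
  have hle := hf _ p B ((nonneg_iff_isPositive _).1 hpn) ((nonneg_iff_isPositive _).1 hBn) hpB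
  rw [cfc_apply_of_not_continuousOn (p := (0 ≤ ·)) B hnc, cfc_isStarProjection hp, hc 1 one_pos] at hle
  have h3 : ((c : ℝ) - f 0) • p ≤ 0 :=
    (le_add_of_nonneg_left (smul_nonneg (f 0).2 zero_le_one)).trans hle
  have hpos : 0 < (c : ℝ) - f 0 := sub_pos.2 (by exact_mod_cast h0)
  have h4 : ((c : ℝ) - f 0) • p = 0 := le_antisymm h3 (smul_nonneg hpos.le hpn)
  exact (smul_ne_zero hpos.ne' hp0) h4

/-- Every nonconstant operator monotone function
`f : [0,∞) → [0,∞)` is injective. -/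
theorem nonconstant_operatorMonotone_injective (f : ℝ≥0 → ℝ≥0)
    (hf : OperatorMonotone f) (hnc : ¬ ∃ c : ℝ≥0, ∀ x, f x = c) :
    Function.Injective f := by
  have key : ∀ a b : ℝ≥0, a < b → f a ≠ f b := by
    intro a b hab hfab
    have hpos : ∀ x, 0 < x → f x = f b := by
      intro x hx
      rcases lt_trichotomy x a with h | rfl | h
      · exact (eq_of_eq_of_lt hf hab hfab hx h).trans hfab
      · exact hfab
      · rcases le_or_gt x b with h' | h'
        · exact le_antisymm (hf.monotone h') (hfab ▸ hf.monotone h.le)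
        · exact eq_of_eq_of_gt hf hab hfab h'
    rcases (hf.monotone (zero_le (a := b))).lt_or_eq with h | h
    · obtain ⟨p, B, hp, hp0, hpB, hB⟩ := exists_isStarProjection_le_of_geometric_spectrum
      exact h.not_ge (hf.apply_zero_ge hpos hp hp0 hpB hB)
    · refine hnc ⟨f b, fun x => ?_⟩
      rcases eq_zero_or_pos x with rfl | hx
      · exact h
      · exact hpos x hx
  intro a b hab
  by_contra hne
  rcases lt_or_gt_of_ne hne with h | h
  · exact key a b h hab
  · exact key b a h hab.symm

end
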